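/- Let P be a FASP program whose positive dependency graph has no loops. Then an interpretation I of P is an answer set of P if and only if I is a model of the completion comp(P). -/

import Mathlib

/-- A t-norm on `[0,1]`: an increasing (in each argument), commutative and associative
binary operator on `[0,1]` with neutral element `1`. -/
structure Tnorm where
  T : ℝ → ℝ → ℝ
  mem_Icc : ∀ x ∈ Set.Icc (0:ℝ) 1, ∀ y ∈ Set.Icc (0:ℝ) 1, T x y ∈ Set.Icc (0:ℝ) 1
  mono : ∀ x ∈ Set.Icc (0:ℝ) 1, ∀ x' ∈ Set.Icc (0:ℝ) 1, ∀ y ∈ Set.Icc (0:ℝ) 1,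
    ∀ y' ∈ Set.Icc (0:ℝ) 1, x ≤ x' → y ≤ y' → T x y ≤ T x' y'
  comm : ∀ x ∈ Set.Icc (0:ℝ) 1, ∀ y ∈ Set.Icc (0:ℝ) 1, T x y = T y x
  assoc : ∀ x ∈ Set.Icc (0:ℝ) 1, ∀ y ∈ Set.Icc (0:ℝ) 1, ∀ z ∈ Set.Icc (0:ℝ) 1,
    T (T x y) z = T x (T y z)
  one_T : ∀ x ∈ Set.Icc (0:ℝ) 1, T 1 x = x

/-- Left continuity of a t-norm in each argument (on `[0,1]`). -/
def Tnorm.LeftContinuous (Tn : Tnorm) : Prop :=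
  ∀ x ∈ Set.Icc (0:ℝ) 1, ∀ y ∈ Set.Icc (0:ℝ) 1,
    ContinuousWithinAt (fun t => Tn.T x t) (Set.Icc (0:ℝ) y) y ∧
    ContinuousWithinAt (fun t => Tn.T t y) (Set.Icc (0:ℝ) x) x

/-- The residual implicator of a t-norm: `I_T(x,y) = sup { λ ∈ [0,1] | T(x,λ) ≤ y }`. -/
noncomputable def Tnorm.resid (Tn : Tnorm) (x y : ℝ) : ℝ :=
  sSup { l | l ∈ Set.Icc (0:ℝ) 1 ∧ Tn.T x l ≤ y }

/-- The n-ary extension of a t-norm: `T(b) = b`, `T(b₁,…,bₙ) = T(b₁, T(b₂,…,bₙ))`. -/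
def Tnorm.listEval (Tn : Tnorm) : List ℝ → ℝ
  | [] => 1
  | [x] => x
  | x :: xs => Tn.T x (Tn.listEval xs)

/-- A negator: a decreasing `[0,1] → [0,1]` map with `N(0) = 1` and `N(1) = 0`. -/
structure Negator where
  N : ℝ → ℝ
  mem_Icc : ∀ x ∈ Set.Icc (0:ℝ) 1, N x ∈ Set.Icc (0:ℝ) 1
  anti : ∀ x ∈ Set.Icc (0:ℝ) 1, ∀ y ∈ Set.Icc (0:ℝ) 1, x ≤ y → N y ≤ N x
  N_zero : N 0 = 1
  N_one : N 1 = 0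

/-- A body element of a FASP rule: an atom, a constant from `[0,1]`, or a negated atom. -/
inductive Lit (α : Type*) where
  | pos : α → Lit α
  | const : ℝ → Lit α
  | neg : Negator → α → Lit α

/-- A FASP rule `a ← T(b₁,…,bₙ)`: a head (an atom or a constant in `[0,1]`), a body
(a list of extended literals, combined by the rule's t-norm). -/
structure Rule (α : Type*) where
  head : α ⊕ ℝ
  body : List (Lit α)
  tnorm : Tnorm

/-- Well-formedness of a literal: constants must lie in `[0,1]`. -/
def Lit.WF {α : Type*} : Lit α → Prop
  | .const c => c ∈ Set.Icc (0:ℝ) 1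
  | _ => True

/-- Well-formedness of a rule: nonempty body, constants in `[0,1]`, and a
left-continuous t-norm. -/
def Rule.WF {α : Type*} (r : Rule α) : Prop :=
  r.body ≠ [] ∧ (∀ l ∈ r.body, l.WF) ∧ r.tnorm.LeftContinuous ∧
    ∀ c : ℝ, r.head = Sum.inr c → c ∈ Set.Icc (0:ℝ) 1

/-- Well-formedness of a FASP program (a set of rules). -/
def ProgramWF {α : Type*} (P : Set (Rule α)) : Prop := ∀ r ∈ P, r.WF

/-- An interpretation maps every atom to a value in `[0,1]`. -/
def IsInterp {α : Type*} (I : α → ℝ) : Prop := ∀ a, I a ∈ Set.Icc (0:ℝ) 1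

/-- Evaluation of an extended literal: `I(c) = c`, `I(N(b)) = N(I(b))`. -/
def Lit.eval {α : Type*} (I : α → ℝ) : Lit α → ℝ
  | .pos a => I a
  | .const c => c
  | .neg n a => n.N (I a)

/-- Evaluation of a rule body: `I(body(r)) = T_r(I(b₁),…,I(bₙ))`. -/
def Rule.evalBody {α : Type*} (I : α → ℝ) (r : Rule α) : ℝ :=
  r.tnorm.listEval (r.body.map (Lit.eval I))

/-- Evaluation of a rule head. -/
def evalHead {α : Type*} (I : α → ℝ) : α ⊕ ℝ → ℝ
  | .inl a => I a
  | .inr c => c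

/-- The atoms occurring positively (non-negated) in the body of a rule. -/
def Rule.posbody {α : Type*} (r : Rule α) : Set α := { a | Lit.pos a ∈ r.body }

/-- The immediate consequence operator:
`Π_P(I)(a) = sup { I(body(r)) | r ∈ P_a }` (with `sup ∅ = 0`). -/
noncomputable def PiOp {α : Type*} (P : Set (Rule α)) (I : α → ℝ) : α → ℝ :=
  fun a => sSup { x | ∃ r ∈ P, r.head = Sum.inl a ∧ x = r.evalBody I }

/-- `I` is a model of `P` iff `I(r) = I_r(I(body(r)), I(head(r))) = 1` for all `r ∈ P`. -/
def IsModel {α : Type*} (P : Set (Rule α)) (I : α → ℝ) : Prop :=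
  ∀ r ∈ P, r.tnorm.resid (r.evalBody I) (evalHead I r.head) = 1

/-- The support of an interpretation: `supp(I) = { a | I(a) > 0 }`. -/
def supp {α : Type*} (I : α → ℝ) : Set α := { a | 0 < I a }

/-- `U` is unfounded w.r.t. `I`: for each `u ∈ U` and rule `r ∈ P_u`, either
`U ∩ posbody(r) ≠ ∅`, or `I(u) > I(body(r))`, or `I(body(r)) = 0`. -/
def Unfounded {α : Type*} (P : Set (Rule α)) (I : α → ℝ) (U : Set α) : Prop :=
  ∀ u ∈ U, ∀ r ∈ P, r.head = Sum.inl u →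
    (U ∩ r.posbody).Nonempty ∨ r.evalBody I < I u ∨ r.evalBody I = 0

/-- `I` is unfounded-free iff `supp(I) ∩ U = ∅` for every unfounded set `U`. -/
def UnfoundedFree {α : Type*} (P : Set (Rule α)) (I : α → ℝ) : Prop :=
  ∀ U : Set α, Unfounded P I U → supp I ∩ U = ∅

/-- An answer set of `P` is an unfounded-free model of `P`. -/
def IsAnswerSet {α : Type*} (P : Set (Rule α)) (I : α → ℝ) : Prop :=
  IsModel P I ∧ UnfoundedFree P I

/-- The reduct of a literal w.r.t. `I`: every negated atom `N(b)` is replaced by the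
constant `N(I(b))`. -/
def Lit.reduct {α : Type*} (I : α → ℝ) : Lit α → Lit α
  | .neg n a => .const (n.N (I a))
  | l => l

/-- The reduct of a rule w.r.t. `I`. -/
def Rule.reduct {α : Type*} (I : α → ℝ) (r : Rule α) : Rule α :=
  ⟨r.head, r.body.map (Lit.reduct I), r.tnorm⟩

/-- The reduct of a program: `P^I = { r^I | r ∈ P }`. -/
def reduct {α : Type*} (P : Set (Rule α)) (I : α → ℝ) : Set (Rule α) :=
  (Rule.reduct I) '' P

/-- `F` is the least fixpoint of `Π_P` (among interpretations). -/
def IsLfp {α : Type*} (P : Set (Rule α)) (F : α → ℝ) : Prop :=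
  IsInterp F ∧ PiOp P F = F ∧
    ∀ G : α → ℝ, IsInterp G → PiOp P G = G → ∀ a, F a ≤ G a

/-- `I` is a model of the completion `comp(P)`: for every atom `a`,
`I(a) = sup { I(body(r)) | r ∈ P_a }` (with `sup ∅ = 0`), and for every rule with a
constant head `c`, `I(body(r)) ≤ c`. -/
def ModelsComp {α : Type*} (P : Set (Rule α)) (I : α → ℝ) : Prop :=
  (∀ a, I a = sSup { x | ∃ r ∈ P, r.head = Sum.inl a ∧ x = r.evalBody I }) ∧
  (∀ r ∈ P, ∀ c : ℝ, r.head = Sum.inr c → r.evalBody I ≤ c)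

/-- Edge of the positive dependency graph of `P`: `(a,b)` iff some rule with head `a`
has `b` occurring positively in its body. -/
def depEdge {α : Type*} (P : Set (Rule α)) (a b : α) : Prop :=
  ∃ r ∈ P, r.head = Sum.inl a ∧ b ∈ r.posbody

/-- A loop of `P`: a nonempty set `L` of atoms such that any two elements of `L` are
joined by a path of positive length in the positive dependency graph all of whose
vertices lie in `L`. -/
def IsLoop {α : Type*} (P : Set (Rule α)) (L : Set α) : Prop :=
  L.Nonempty ∧ ∀ a ∈ L, ∀ b ∈ L,
    Relation.TransGen (fun u v => depEdge P u v ∧ u ∈ L ∧ v ∈ L) a b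

/-- `R⁻(P,L)`: the rules of `P` with head in `L` whose positive body is disjoint
from `L`. -/
def extRules {α : Type*} (P : Set (Rule α)) (L : Set α) : Set (Rule α) :=
  { r | r ∈ P ∧ (∃ a ∈ L, r.head = Sum.inl a) ∧ r.posbody ∩ L = ∅ }

/-- `I` satisfies the loop formula `LF(L,P)` iff
`max { I(l) | l ∈ L } ≤ max { I(body(r)) | r ∈ R⁻(P,L) }` (right-hand side `0` when
`R⁻(P,L) = ∅`). -/
def SatLF {α : Type*} (P : Set (Rule α)) (L : Set α) (I : α → ℝ) : Prop :=
  sSup (I '' L) ≤ sSup { x | ∃ r ∈ extRules P L, x = r.evalBody I }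

/-- A simple program: no rule body contains a negated atom. -/
def Simple {α : Type*} (P : Set (Rule α)) : Prop :=
  ∀ r ∈ P, ∀ l ∈ r.body, ∀ (n : Negator) (a : α), l ≠ Lit.neg n a

theorem Tnorm.T_le_left (Tn : Tnorm) {x y : ℝ} (hx : x ∈ Set.Icc (0:ℝ) 1)
    (hy : y ∈ Set.Icc (0:ℝ) 1) : Tn.T x y ≤ x := by
  have h1 : (1:ℝ) ∈ Set.Icc (0:ℝ) 1 := by simp
  calc Tn.T x y ≤ Tn.T x 1 := Tn.mono x hx x hx y hy 1 h1 le_rfl hy.2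
    _ = x := by rw [Tn.comm x hx 1 h1, Tn.one_T x hx]

theorem Tnorm.T_le_right (Tn : Tnorm) {x y : ℝ} (hx : x ∈ Set.Icc (0:ℝ) 1)
    (hy : y ∈ Set.Icc (0:ℝ) 1) : Tn.T x y ≤ y :=
  Tn.comm x hx y hy ▸ Tn.T_le_left hy hx

theorem Tnorm.resid_eq_one_iff {Tn : Tnorm} (hT : Tn.LeftContinuous) {x y : ℝ}
    (hx : x ∈ Set.Icc (0:ℝ) 1) : Tn.resid x y = 1 ↔ x ≤ y := by
  have h1 : (1:ℝ) ∈ Set.Icc (0:ℝ) 1 := by simp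
  have hx1 : Tn.T x 1 = x := by rw [Tn.comm x hx 1 h1, Tn.one_T x hx]
  have hub : ∀ l ∈ {l | l ∈ Set.Icc (0:ℝ) 1 ∧ Tn.T x l ≤ y}, l ≤ 1 := fun l hl => hl.1.2
  constructor
  · intro h
    unfold Tnorm.resid at h
    have hne : {l | l ∈ Set.Icc (0:ℝ) 1 ∧ Tn.T x l ≤ y}.Nonempty := by
      by_contra hne
      rw [Set.not_nonempty_iff_eq_empty.1 hne, Real.sSup_empty] at h
      exact zero_ne_one h
    have hcl := csSup_mem_closure hne ⟨1, hub⟩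
    rw [h] at hcl
    have hmem := ((hT x hx 1 h1).1.mono fun l hl => hl.1).mem_closure hcl
      (t := Set.Iic y) fun l hl => hl.2
    rw [isClosed_Iic.closure_eq] at hmem
    exact hx1 ▸ hmem
  · intro h
    exact (IsGreatest.csSup_eq ⟨⟨h1, hx1.le.trans h⟩, hub⟩)

theorem Tnorm.listEval_mem_Icc (Tn : Tnorm) :
    ∀ l : List ℝ, (∀ x ∈ l, x ∈ Set.Icc (0:ℝ) 1) → Tn.listEval l ∈ Set.Icc (0:ℝ) 1
  | [], _ => by simp [Tnorm.listEval]
  | [x], h => h x (by simp)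
  | x :: y :: l, h => Tn.mem_Icc x (h x (by simp)) _
      (Tn.listEval_mem_Icc (y :: l) fun z hz => h z (List.mem_cons_of_mem _ hz))

theorem Tnorm.listEval_le (Tn : Tnorm) :
    ∀ l : List ℝ, (∀ x ∈ l, x ∈ Set.Icc (0:ℝ) 1) → ∀ x ∈ l, Tn.listEval l ≤ x
  | [], _, x, hx => by simp at hx
  | [y], _, x, hx => by
      rw [List.mem_singleton.1 hx]
      exact le_rfl
  | y :: z :: l, h, x, hx => by
      have hy := h y (by simp)
      have hl : ∀ w ∈ z :: l, w ∈ Set.Icc (0:ℝ) 1 := fun w hw => h w (List.mem_cons_of_mem _ hw)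
      have hmem := Tn.listEval_mem_Icc (z :: l) hl
      rcases List.mem_cons.1 hx with rfl | hx
      · exact Tn.T_le_left hy hmem
      · exact (Tn.T_le_right hy hmem).trans (Tn.listEval_le (z :: l) hl x hx)

theorem Lit.eval_mem_Icc {α : Type*} {I : α → ℝ} (hI : IsInterp I) {l : Lit α} (hl : l.WF) :
    l.eval I ∈ Set.Icc (0:ℝ) 1 := by
  cases l with
  | pos a => exact hI a
  | const c => exact hl
  | neg n a => exact n.mem_Icc _ (hI a)

theorem Rule.WF.eval_mem_Icc {α : Type*} {I : α → ℝ} (hI : IsInterp I) {r : Rule α}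
    (hr : r.WF) : ∀ x ∈ r.body.map (Lit.eval I), x ∈ Set.Icc (0:ℝ) 1 := by
  intro x hx
  obtain ⟨l, hl, rfl⟩ := List.mem_map.1 hx
  exact Lit.eval_mem_Icc hI (hr.2.1 l hl)

theorem Rule.WF.evalBody_mem_Icc {α : Type*} {I : α → ℝ} (hI : IsInterp I) {r : Rule α}
    (hr : r.WF) : r.evalBody I ∈ Set.Icc (0:ℝ) 1 :=
  r.tnorm.listEval_mem_Icc _ (hr.eval_mem_Icc hI)

theorem Rule.WF.evalBody_le {α : Type*} {I : α → ℝ} (hI : IsInterp I) {r : Rule α}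
    (hr : r.WF) {a : α} (ha : a ∈ r.posbody) : r.evalBody I ≤ I a :=
  r.tnorm.listEval_le _ (hr.eval_mem_Icc hI) _ (List.mem_map.2 ⟨_, ha, rfl⟩)

theorem isModel_iff {α : Type*} {P : Set (Rule α)} (hwf : ProgramWF P) {I : α → ℝ}
    (hI : IsInterp I) : IsModel P I ↔ ∀ r ∈ P, r.evalBody I ≤ evalHead I r.head :=
  forall₂_congr fun r hr =>
    Tnorm.resid_eq_one_iff (hwf r hr).2.2.1 ((hwf r hr).evalBody_mem_Icc hI)

theorem isLoop_of_transGen_self {α : Type*} {P : Set (Rule α)} {a : α}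
    (h : Relation.TransGen (depEdge P) a a) :
    IsLoop P {b | Relation.TransGen (depEdge P) a b ∧ Relation.TransGen (depEdge P) b a} := by
  refine ⟨⟨a, h, h⟩, fun x hx y hy => ?_⟩
  have hxy := hx.2.trans hy.1
  have hax := hx.1
  clear hx
  induction hxy using Relation.TransGen.head_induction_on with
  | single hxy => exact .single ⟨hxy, ⟨hax, .head hxy hy.2⟩, hy⟩
  | head hxz hzy ih =>
    have haz := hax.tail hxz
    have hza := hzy.trans hy.2
    exact .head ⟨hxz, ⟨hax, hza.head hxz⟩, haz, hza⟩ (ih haz)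

theorem wellFounded_flip_transGen_depEdge {α : Type*} [Finite α] {P : Set (Rule α)}
    (hnoloop : ∀ L : Set α, ¬ IsLoop P L) :
    WellFounded (flip (Relation.TransGen (depEdge P))) :=
  haveI : IsTrans α (flip (Relation.TransGen (depEdge P))) := ⟨fun _ _ _ h h' => h'.trans h⟩
  haveI : Std.Irrefl (flip (Relation.TransGen (depEdge P))) :=
    ⟨fun _ h => hnoloop _ (isLoop_of_transGen_self h)⟩
  Finite.wellFounded_of_trans_of_irrefl _

theorem bodyValues_bddAbove {α : Type*} {P : Set (Rule α)} (hwf : ProgramWF P) {I : α → ℝ}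
    (hI : IsInterp I) (a : α) :
    BddAbove {x | ∃ r ∈ P, r.head = Sum.inl a ∧ x = r.evalBody I} := by
  refine ⟨1, ?_⟩
  rintro _ ⟨r, hr, -, rfl⟩
  exact ((hwf r hr).evalBody_mem_Icc hI).2

theorem IsAnswerSet.modelsComp {α : Type*} {P : Set (Rule α)} (hwf : ProgramWF P) {I : α → ℝ}
    (hI : IsInterp I) (h : IsAnswerSet P I) : ModelsComp P I := by
  have hmod := (isModel_iff hwf hI).1 h.1
  refine ⟨fun a => le_antisymm ?_ ?_, fun r hr c hc => by simpa [hc, evalHead] using hmod r hr⟩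
  · by_contra! hlt
    have hU : Unfounded P I {a} := by
      rintro u rfl r hr hru
      exact .inr (.inl ((le_csSup (bodyValues_bddAbove hwf hI u) ⟨r, hr, hru, rfl⟩).trans_lt hlt))
    have hpos : 0 < I a := by
      refine (Real.sSup_nonneg ?_).trans_lt hlt
      rintro _ ⟨r, hr, -, rfl⟩
      exact ((hwf r hr).evalBody_mem_Icc hI).1
    exact (Set.eq_empty_iff_forall_notMem.1 (h.2 {a} hU) a) ⟨hpos, rfl⟩
  · refine Real.sSup_le ?_ (hI a).1
    rintro _ ⟨r, hr, hra, rfl⟩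
    simpa [hra, evalHead] using hmod r hr

theorem ModelsComp.isModel {α : Type*} {P : Set (Rule α)} (hwf : ProgramWF P) {I : α → ℝ}
    (hI : IsInterp I) (h : ModelsComp P I) : IsModel P I := by
  refine (isModel_iff hwf hI).2 fun r hr => ?_
  rcases hh : r.head with a | c
  · exact (le_csSup (bodyValues_bddAbove hwf hI a) ⟨r, hr, hh, rfl⟩).trans_eq (h.1 a).symm
  · exact h.2 r hr c hh

theorem ModelsComp.exists_evalBody_eq {α : Type*} {P : Set (Rule α)} (hfin : P.Finite)
    {I : α → ℝ} (h : ModelsComp P I) {a : α} (ha : 0 < I a) :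
    ∃ r ∈ P, r.head = Sum.inl a ∧ I a = r.evalBody I := by
  have hne : {x | ∃ r ∈ P, r.head = Sum.inl a ∧ x = r.evalBody I}.Nonempty := by
    by_contra hne
    have := h.1 a
    rw [Set.not_nonempty_iff_eq_empty.1 hne, Real.sSup_empty] at this
    exact ha.ne' this
  have hf : {x | ∃ r ∈ P, r.head = Sum.inl a ∧ x = r.evalBody I}.Finite := by
    refine (hfin.image (Rule.evalBody I)).subset ?_
    rintro _ ⟨r, hr, -, rfl⟩
    exact ⟨r, hr, rfl⟩
  have hmem := hne.csSup_mem hf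
  rwa [← h.1 a] at hmem

theorem ModelsComp.unfoundedFree {α : Type*} [Finite α] {P : Set (Rule α)} (hfin : P.Finite)
    (hwf : ProgramWF P) (hnoloop : ∀ L : Set α, ¬ IsLoop P L) {I : α → ℝ} (hI : IsInterp I)
    (h : ModelsComp P I) : UnfoundedFree P I := by
  intro U hU
  by_contra hne
  obtain ⟨u, ⟨hu, huU⟩, hmin⟩ := (wellFounded_flip_transGen_depEdge hnoloop).has_min
    (supp I ∩ U) (Set.nonempty_iff_ne_empty.2 hne)
  obtain ⟨r, hr, hru, hval⟩ := h.exists_evalBody_eq hfin hu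
  have hpos : 0 < r.evalBody I := hval ▸ hu
  rcases hU u huU r hr hru with ⟨v, hvU, hvr⟩ | hlt | hzero
  · exact hmin v ⟨hpos.trans_le ((hwf r hr).evalBody_le hI hvr), hvU⟩ (.single ⟨r, hr, hru, hvr⟩)
  · exact hlt.ne' hval
  · exact hpos.ne' hzero

/-- if the positive dependency graph of `P` has no loops, then an
interpretation `I` of `P` is an answer set of `P` iff `I` is a model of the
completion `comp(P)`. -/
theorem answerSet_iff_modelsComp_of_noLoops {α : Type*} [Finite α]
    (P : Set (Rule α)) (hfin : P.Finite) (hwf : ProgramWF P)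
    (hnoloop : ∀ L : Set α, ¬ IsLoop P L)
    (I : α → ℝ) (hI : IsInterp I) :
    IsAnswerSet P I ↔ ModelsComp P I :=
  ⟨fun h => h.modelsComp hwf hI,
    fun h => ⟨h.isModel hwf hI, h.unfoundedFree hfin hwf hnoloop hI⟩⟩
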